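/- If $n=2m+1>13$ and $Q_{4m}(z)=(2m+1)z^{2m}+(-1)^m\sum_{j=1}^m(z^{2m-2j}+z^{2m+2j})$, then there is no polynomial $P\in\mathcal{L}_{2m}$ (degree $2m$, all coefficients in $\{-1,1\}$) with $Q_{4m}(z)=P(z)P^*(z)$, where $P^*(z)=z^{2m}P(1/z)$. -/

import Mathlib

open Finset Polynomial

/-- Modulo `2`, only the diagonal term of a signed self-convolution at an even index survives. -/
theorem even_sum_antidiagonal_sub_sq (v : ℕ → ℤ) (j : ℕ) :
    (2 : ℤ) ∣ ∑ x ∈ antidiagonal (2 * j), (-1) ^ x.1 * (v x.1 * v x.2) - v j ^ 2 := by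
  refine (ZMod.intCast_zmod_eq_zero_iff_dvd _ 2).1 ?_
  have hmem : (j, j) ∈ antidiagonal (2 * j) := by simp; omega
  rw [← Finset.add_sum_erase _ _ hmem]
  have hneg : (-1 : ZMod 2) = 1 := by decide
  have hzero : ∑ x ∈ (antidiagonal (2 * j)).erase (j, j), ((v x.1 : ZMod 2) * v x.2) = 0 := by
    refine Finset.sum_involution (fun x _ => x.swap) ?_ ?_ ?_ ?_
    · intro x _
      simp only [Prod.fst_swap, Prod.snd_swap]
      rw [mul_comm (v x.2 : ZMod 2), CharTwo.add_self_eq_zero]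
    · rintro ⟨a, b⟩ hx _ h
      simp only [mem_erase, Finset.HasAntidiagonal.mem_antidiagonal, ne_eq, Prod.mk.injEq,
        Prod.swap_prod_mk] at hx h
      omega
    · rintro ⟨a, b⟩ hx
      simp only [mem_erase, Finset.HasAntidiagonal.mem_antidiagonal, ne_eq, Prod.mk.injEq,
        Prod.swap_prod_mk] at hx ⊢
      omega
    · intro x _
      simp
  push_cast
  simp only [hneg, one_pow, one_mul]
  rw [hzero]
  ring

theorem eq_zero_iff_of_two_dvd_sub_sq {x y : ℤ} (hx : |x| ≤ 1) (hy : |y| ≤ 1)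
    (h : (2 : ℤ) ∣ x + y ^ 2) : x = 0 ↔ y = 0 := by
  rw [abs_le] at hx hy
  obtain ⟨hx1, hx2⟩ := hx
  obtain ⟨hy1, hy2⟩ := hy
  interval_cases x <;> interval_cases y <;> revert h <;> decide

/-- Half-differences `v i` of a normalized Barker sequence cannot exist for `7 ≤ m`: if `p` is the
first index where `v` is nonzero, the recurrence forces `v` to be supported on multiples of `p`
below `2 m - p`, and this is incompatible with skew-symmetry. -/
theorem half_difference_contradiction (m : ℕ) (hm : 7 ≤ m) (v : ℕ → ℤ)
    (h0 : v 0 = 0) (h1 : v 1 = 0) (hv : ∀ i ≤ 2 * m, |v i| ≤ 1)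
    (hrec : ∀ j, 1 ≤ j → j < m →
      v (2 * j) + ∑ x ∈ antidiagonal (2 * j), (-1) ^ x.1 * (v x.1 * v x.2) = 0)
    (hskew : ∀ k, 1 ≤ k → k ≤ 2 * m → (v k = 0 ↔ v (2 * m + 1 - k) ≠ 0)) : False := by
  classical
  have hdouble : ∀ j, 1 ≤ j → j < m → (v (2 * j) = 0 ↔ v j = 0) := by
    intro j hj hjm
    refine eq_zero_iff_of_two_dvd_sub_sq (hv _ (by omega)) (hv _ (by omega)) ?_
    have := even_sum_antidiagonal_sub_sq v j
    have := hrec j hj hjm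
    omega
  -- the first index with `v p ≠ 0`
  have hex : ∃ p, v p ≠ 0 ∧ p ≤ m + 1 := by
    by_cases h : v m = 0
    · exact ⟨m + 1, by simpa [show 2 * m + 1 - m = m + 1 by omega] using
        (hskew m (by omega) (by omega)).1 h, le_rfl⟩
    · exact ⟨m, h, by omega⟩
  obtain ⟨p, ⟨hp, hpm⟩, hmin⟩ :
      ∃ p, (v p ≠ 0 ∧ p ≤ m + 1) ∧ ∀ k < p, v k = 0 := by
    refine ⟨Nat.find hex, Nat.find_spec hex, fun k hk => ?_⟩
    have := (Nat.find_spec hex).2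
    by_contra hne
    exact Nat.find_min hex hk ⟨hne, by omega⟩
  have hp0 : p ≠ 0 := fun h => hp (h ▸ h0)
  have hp1 : p ≠ 1 := fun h => hp (h ▸ h1)
  have hpodd : p % 2 = 1 := by
    by_contra hpe
    have h2 := hdouble (p / 2) (by omega) (by omega)
    rw [show 2 * (p / 2) = p by omega] at h2
    exact hp (h2.2 (hmin _ (by omega)))
  have hsupp : ∀ k, k + p < 2 * m → ¬ p ∣ k → v k = 0 := by
    intro k
    induction k using Nat.strong_induction_on with
    | _ k ih =>
    intro hk hpk
    have hk0 : k ≠ 0 := fun h => hpk (h ▸ dvd_zero p)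
    rcases Nat.even_or_odd' k with ⟨j, rfl | rfl⟩
    · exact (hdouble j (by omega) (by omega)).2
        (ih j (by omega) (by omega) fun h => hpk (h.mul_left 2))
    · by_cases hlt : 2 * j + 1 < p
      · exact hmin _ hlt
      have hne : 2 * j + 1 ≠ p := fun h => hpk (h ▸ dvd_rfl)
      obtain ⟨N, hN⟩ : ∃ N, 2 * j + 1 + p = 2 * N := ⟨(2 * j + 1 + p) / 2, by omega⟩
      have hr := hrec N (by omega) (by omega)
      have hpN : ¬ p ∣ 2 * N := by rwa [← hN, Nat.dvd_add_left dvd_rfl]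
      have hsum : ∑ x ∈ antidiagonal (2 * N), (-1) ^ x.1 * (v x.1 * v x.2) =
          ∑ x ∈ {(2 * j + 1, p), (p, 2 * j + 1)}, (-1) ^ x.1 * (v x.1 * v x.2) := by
        symm
        refine Finset.sum_subset ?_ ?_
        · intro x hx
          simp only [mem_insert, mem_singleton] at hx
          rcases hx with rfl | rfl <;> simp <;> omega
        · rintro ⟨a, b⟩ hx hx'
          simp only [Finset.HasAntidiagonal.mem_antidiagonal, mem_insert, mem_singleton,
            Prod.mk.injEq, not_or] at hx hx'
          have hab : v a = 0 ∨ v b = 0 := by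
            by_contra! hab
            have ha : p ≤ a := by
              by_contra! h
              exact hab.1 (hmin a h)
            have hb : p ≤ b := by
              by_contra! h
              exact hab.2 (hmin b h)
            by_cases hpa : p ∣ a
            · have hpb : ¬ p ∣ b := fun h => hpN (hx ▸ dvd_add hpa h)
              exact hab.2 (ih b (by omega) (by omega) hpb)
            · exact hab.1 (ih a (by omega) (by omega) hpa)
          rcases hab with h | h <;> simp [h]
      rw [hsum, Finset.sum_pair (by simp [hne])] at hr
      have o1 : (-1 : ℤ) ^ (2 * j + 1) = -1 := Odd.neg_one_pow ⟨j, rfl⟩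
      have o2 : (-1 : ℤ) ^ p = -1 := Odd.neg_one_pow (Nat.odd_iff.2 hpodd)
      simp only [o1, o2] at hr
      have hvN := abs_le.1 (hv (2 * N) (by omega))
      have hprod : v (2 * j + 1) * v p = 0 := by
        have : v (2 * N) = 2 * (v (2 * j + 1) * v p) := by linarith
        omega
      exact (mul_eq_zero.1 hprod).resolve_right hp
  have hpair : ∀ k, 1 ≤ k → k + p < 2 * m → 2 * m + 1 - k + p < 2 * m →
      p ∣ k ∨ p ∣ 2 * m + 1 - k := by
    intro k hk1 hk2 hk3
    by_contra! h
    exact (hskew k hk1 (by omega)).1 (hsupp k hk2 h.1) (hsupp _ hk3 h.2)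
  have hsmall : ∀ d, 1 ≤ d → d < 3 → ∀ k, p ∣ k → ¬ p ∣ k + d := by
    intro d hd hd3 k hk hkd
    have := Nat.le_of_dvd (by omega) ((Nat.dvd_add_right hk).1 hkd)
    omega
  have hlarge : m ≤ p + 1 := by
    by_contra! hlt
    have hA := hpair m (by omega) (by omega) (by omega)
    rw [show 2 * m + 1 - m = m + 1 by omega] at hA
    by_cases heq : m = p + 2
    · rcases hA with h | h
      · have h2 : p ∣ 2 := (Nat.dvd_add_right dvd_rfl).1 (heq ▸ h)
        have := Nat.le_of_dvd (by omega) h2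
        omega
      · rw [heq, add_assoc] at h
        have h2 : p ∣ 3 := (Nat.dvd_add_right dvd_rfl).1 h
        have := Nat.le_of_dvd (by omega) h2
        omega
    · have hB := hpair (m - 1) (by omega) (by omega) (by omega)
      rw [show 2 * m + 1 - (m - 1) = m + 2 by omega] at hB
      rcases hA with h | h <;> rcases hB with h' | h'
      · exact hsmall 1 (by omega) (by omega) _ h' (by rwa [show m - 1 + 1 = m by omega])
      · exact hsmall 2 (by omega) (by omega) _ h h'
      · exact hsmall 2 (by omega) (by omega) _ h' (by rwa [show m - 1 + 2 = m + 1 by omega])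
      · exact hsmall 1 (by omega) (by omega) _ h h'
  obtain ⟨j, hj1, hj2, hj3, hj4⟩ : ∃ j, 1 ≤ j ∧ j < m ∧ j < p ∧ 2 * m + 2 ≤ 2 * j + p := by
    rcases le_total p m with h | h
    · exact ⟨p - 1, by omega, by omega, by omega, by omega⟩
    · exact ⟨m - 1, by omega, by omega, by omega, by omega⟩
  exact (hskew (2 * j) (by omega) (by omega)).1 ((hdouble j hj1 hj2).2 (hmin j hj3))
    (hmin _ (by omega))

/-- The generating-function identity `(1 - z) A(z) (1 + z) A(-z) = (1 - z²) A(z) A(-z)`, read off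
at even coefficients, where `(1 - z) A(z) = 1 + 2 V(z)`. -/
theorem half_difference_recurrence (a v : ℕ → ℤ) (h0 : v 0 = 0) (ha0 : a 0 = 1)
    (hav : ∀ i, a (i + 1) = a i + 2 * v (i + 1)) (j : ℕ)
    (hD : ∑ x ∈ antidiagonal (2 * (j + 1)), (-1) ^ x.1 * (a x.1 * a x.2) =
      ∑ x ∈ antidiagonal (2 * j), (-1) ^ x.1 * (a x.1 * a x.2)) :
    v (2 * (j + 1)) +
      ∑ x ∈ antidiagonal (2 * (j + 1)), (-1) ^ x.1 * (v x.1 * v x.2) = 0 := by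
  let S (f : ℕ → ℤ) : PowerSeries ℤ := PowerSeries.mk f
  let T (f : ℕ → ℤ) : PowerSeries ℤ := PowerSeries.mk fun i => (-1) ^ i * f i
  have hTS (f : ℕ → ℤ) (N : ℕ) : PowerSeries.coeff N (T f * S f) =
      ∑ x ∈ antidiagonal N, (-1) ^ x.1 * (f x.1 * f x.2) := by
    simp [S, T, PowerSeries.coeff_mul, PowerSeries.coeff_mk, mul_assoc]
  have hS : (1 - PowerSeries.X) * S a = 1 + (2 : ℤ) • S v := by
    ext i
    cases i with
    | zero => simp [S, h0, ha0, sub_mul]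
    | succ i =>
      rw [map_add, map_smul]
      simp [S, sub_mul, PowerSeries.coeff_succ_X_mul, PowerSeries.coeff_one, hav,
        -zsmul_eq_mul]
  have hT : (1 + PowerSeries.X) * T a = 1 + (2 : ℤ) • T v := by
    ext i
    cases i with
    | zero => simp [T, h0, ha0, add_mul]
    | succ i =>
      rw [map_add, map_smul]
      simp [T, add_mul, PowerSeries.coeff_succ_X_mul, PowerSeries.coeff_one, hav,
        -zsmul_eq_mul]
      ring
  have hmul : (T a * S a) - PowerSeries.X ^ 2 * (T a * S a) =
      1 + (2 : ℤ) • S v + (2 : ℤ) • T v + (4 : ℤ) • (T v * S v) := by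
    have : (1 + (2 : ℤ) • T v) * (1 + (2 : ℤ) • S v) =
        1 + (2 : ℤ) • S v + (2 : ℤ) • T v + (4 : ℤ) • (T v * S v) := by
      simp only [zsmul_eq_mul]
      push_cast
      ring
    rw [← this, ← hS, ← hT]
    ring
  have hc := congrArg (PowerSeries.coeff (2 * (j + 1))) hmul
  rw [map_sub, map_add, map_add, map_add, map_smul, map_smul, map_smul, hTS, hTS,
    show 2 * (j + 1) = 2 * j + 2 by ring, PowerSeries.coeff_X_pow_mul, hTS] at hc
  rw [show 2 * (j + 1) = 2 * j + 2 by ring] at hD ⊢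
  have he : (-1 : ℤ) ^ (2 * j + 2) = 1 := Even.neg_one_pow ⟨j + 1, by ring⟩
  simp only [S, T, PowerSeries.coeff_mk, PowerSeries.coeff_one, he, smul_eq_mul, one_mul] at hc
  rw [if_neg (by omega)] at hc
  linarith

theorem four_dvd_sign_mul_sub {x y : ℤ} (hx : x = 1 ∨ x = -1) (hy : y = 1 ∨ y = -1) :
    (4 : ℤ) ∣ x * y - (x + y - 1) := by
  rcases hx with rfl | rfl <;> rcases hy with rfl | rfl <;> decide

/-- Consecutive aperiodic autocorrelations determine the product of two opposite signs. -/
theorem four_dvd_autocorrelation_sub (a : ℕ → ℤ) (m : ℕ)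
    (ha : ∀ i ≤ 2 * m, a i = 1 ∨ a i = -1) (k : ℕ) (hk : k ≤ 2 * m) :
    (4 : ℤ) ∣ (∑ i ∈ range (2 * m + 1 - k), a i * a (i + k)) -
      (∑ i ∈ range (2 * m + 1 - (k + 1)), a i * a (i + (k + 1))) - (a (2 * m - k) + a k - 1) := by
  have hlin (l : ℕ) : (4 : ℤ) ∣ (∑ i ∈ range (2 * m + 1 - l), a i * a (i + l)) -
      ∑ i ∈ range (2 * m + 1 - l), (a i + a (i + l) - 1) := by
    rw [← Finset.sum_sub_distrib]
    refine Finset.dvd_sum fun i hi => ?_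
    rw [mem_range] at hi
    exact four_dvd_sign_mul_sub (ha _ (by omega)) (ha _ (by omega))
  have h1 := hlin k
  have h2 := hlin (k + 1)
  have hdiff : ∑ i ∈ range (2 * m + 1 - k), (a i + a (i + k) - 1) -
      ∑ i ∈ range (2 * m + 1 - (k + 1)), (a i + a (i + (k + 1)) - 1) =
        a (2 * m - k) + a k - 1 := by
    rw [show 2 * m + 1 - k = (2 * m - k) + 1 by omega,
      show 2 * m + 1 - (k + 1) = 2 * m - k by omega]
    simp only [Finset.sum_sub_distrib, Finset.sum_add_distrib]
    rw [Finset.sum_range_succ a, Finset.sum_range_succ' (fun i => a (i + k)),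
      Finset.sum_range_succ (fun _ => (1 : ℤ))]
    simp only [zero_add, show ∀ i, i + 1 + k = i + (k + 1) by intro i; ring]
    ring
  omega

/-- A sequence of signs of odd length `2 m + 1` with Barker autocorrelations is
skew-symmetric. -/
theorem barker_skew (a : ℕ → ℤ) (m : ℕ) (ha : ∀ i ≤ 2 * m, a i = 1 ∨ a i = -1)
    (hodd : ∀ k, k % 2 = 1 → ∑ i ∈ range (2 * m + 1 - k), a i * a (i + k) = 0)
    (heven : ∀ k, 1 ≤ k → k ≤ m →
      ∑ i ∈ range (2 * m + 1 - 2 * k), a i * a (i + 2 * k) = (-1) ^ m)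
    (k : ℕ) (hk : k ≤ 2 * m) : a (2 * m - k) = (-1) ^ (m + k) * a k := by
  have h := four_dvd_autocorrelation_sub a m ha k hk
  have hx := ha (2 * m - k) (by omega)
  have hy := ha k hk
  rcases Nat.even_or_odd' k with ⟨j, rfl | rfl⟩
  · rw [hodd (2 * j + 1) (by omega)] at h
    rw [pow_add, Even.neg_one_pow (⟨j, by ring⟩ : Even (2 * j))]
    rcases Nat.eq_zero_or_pos j with rfl | hj
    · have hC : ∑ i ∈ range (2 * m + 1 - 2 * 0), a i * a (i + 2 * 0) = 2 * m + 1 := by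
        rw [Finset.sum_congr rfl (g := fun _ => (1 : ℤ))]
        · simp
        · intro i hi
          rw [mem_range] at hi
          rcases ha i (by omega) with h | h <;> simp [h]
      rw [hC] at h
      rcases Nat.even_or_odd' m with ⟨l, hl | hl⟩
      · rw [Even.neg_one_pow (⟨l, by omega⟩ : Even m)]
        push_cast [hl] at h hx hy ⊢
        omega
      · rw [Odd.neg_one_pow (⟨l, hl⟩ : Odd m)]
        push_cast [hl] at h hx hy ⊢
        omega
    · rw [heven j hj (by omega)] at h
      rcases neg_one_pow_eq_or ℤ m with hm | hm <;> rw [hm] at h ⊢ <;> omega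
  · rw [hodd (2 * j + 1) (by omega), show 2 * j + 1 + 1 = 2 * (j + 1) by ring,
      heven (j + 1) (by omega) (by omega)] at h
    rw [pow_add, Odd.neg_one_pow (⟨j, rfl⟩ : Odd (2 * j + 1))]
    rcases neg_one_pow_eq_or ℤ m with hm | hm <;> rw [hm] at h ⊢ <;> omega

/-- There is no Barker sequence of odd length `2 m + 1` with `7 ≤ m`. -/
theorem no_barker_of_seven_le (a : ℕ → ℤ) (m : ℕ) (hm : 7 ≤ m)
    (ha : ∀ i ≤ 2 * m, a i = 1 ∨ a i = -1)
    (hodd : ∀ k, k % 2 = 1 → ∑ i ∈ range (2 * m + 1 - k), a i * a (i + k) = 0)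
    (heven : ∀ k, 1 ≤ k → k ≤ m →
      ∑ i ∈ range (2 * m + 1 - 2 * k), a i * a (i + 2 * k) = (-1) ^ m) : False := by
  have hskew := barker_skew a m ha hodd heven
  have hconv (j : ℕ) (hj : j < m) :
      ∑ x ∈ antidiagonal (2 * j), (-1) ^ x.1 * (a x.1 * a x.2) = 1 := by
    have h := heven (m - j) (by omega) (by omega)
    rw [Finset.Nat.sum_antidiagonal_eq_sum_range_succ_mk]
    have hs : (-1 : ℤ) ^ m * (-1) ^ m = 1 := by rw [← mul_pow]; simp
    have hcongr : ∑ i ∈ range (2 * m + 1 - 2 * (m - j)), a i * a (i + 2 * (m - j)) =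
        (-1) ^ m * ∑ i ∈ range (2 * j + 1), (-1) ^ i * (a i * a (2 * j - i)) := by
      rw [Finset.mul_sum, show 2 * m + 1 - 2 * (m - j) = 2 * j + 1 by omega]
      refine Finset.sum_congr rfl fun i hi => ?_
      rw [mem_range] at hi
      have hi' := hskew (2 * j - i) (by omega)
      rw [show 2 * m - (2 * j - i) = i + 2 * (m - j) by omega] at hi'
      have hp : (-1 : ℤ) ^ (2 * j - i) = (-1) ^ i := by
        rw [neg_one_pow_eq_pow_mod_two, neg_one_pow_eq_pow_mod_two (n := i)]
        congr 1
        omega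
      rw [hi', pow_add, hp]
      ring
    rw [hcongr] at h
    calc _ = (-1 : ℤ) ^ m * ((-1) ^ m *
          ∑ i ∈ range (2 * j + 1), (-1) ^ i * (a i * a (2 * j - i))) := by
            rw [← mul_assoc, hs, one_mul]
      _ = 1 := by rw [h, hs]
  -- Normalize so that the first two signs are positive.
  set s := a 0 with hs
  set t := a 0 * a 1 with ht
  have hs' : s = 1 ∨ s = -1 := ha 0 (by omega)
  have ht' : t = 1 ∨ t = -1 := by
    rcases ha 0 (by omega) with h | h <;> rcases ha 1 (by omega) with h' | h' <;>
      simp [ht, h, h']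
  have hss : s * s = 1 := by rcases hs' with h | h <;> simp [h]
  have htt : t * t = 1 := by rcases ht' with h | h <;> simp [h]
  let c (i : ℕ) : ℤ := if i ≤ 2 * m then s * t ^ i * a i else 1
  have hc (i : ℕ) : c i = 1 ∨ c i = -1 := by
    by_cases hi : i ≤ 2 * m
    · simp only [c, if_pos hi]
      rcases hs' with h | h <;> rcases ht' with h' | h' <;> rcases ha i hi with h'' | h'' <;>
        rcases neg_one_pow_eq_or ℤ i with h3 | h3 <;> simp [h, h', h'', h3]
    · simp [c, hi]
  let v (i : ℕ) : ℤ := (c i - c (i - 1)) / 2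
  have hcv (i : ℕ) : c (i + 1) = c i + 2 * v (i + 1) := by
    have := hc i
    have := hc (i + 1)
    simp only [v, Nat.add_sub_cancel]
    omega
  have hc0 : c 0 = 1 := by simp [c, ← hs, hss]
  have hc1 : c 1 = 1 := by
    have : (1 : ℕ) ≤ 2 * m := by omega
    simp only [c, if_pos this, pow_one]
    rw [mul_right_comm, ← ht, htt]
  have hcconv (j : ℕ) (hj : j < m) :
      ∑ x ∈ antidiagonal (2 * j), (-1) ^ x.1 * (c x.1 * c x.2) = 1 := by
    refine (Finset.sum_congr rfl fun x hx => ?_).trans (hconv j hj)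
    rw [Finset.HasAntidiagonal.mem_antidiagonal] at hx
    have e1 : c x.1 = s * t ^ x.1 * a x.1 := if_pos (by omega)
    have e2 : c x.2 = s * t ^ x.2 * a x.2 := if_pos (by omega)
    have e3 : t ^ x.1 * t ^ x.2 = 1 := by
      rw [← pow_add, hx, pow_mul, pow_two, htt, one_pow]
    rw [e1, e2]
    linear_combination (-1) ^ x.1 * a x.1 * a x.2 * (s * s * e3 + hss)
  have hcskew (k : ℕ) (hk1 : 1 ≤ k) (hk : k ≤ 2 * m) :
      c k * c (k - 1) = -(c (2 * m + 1 - k) * c (2 * m + 1 - k - 1)) := by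
    obtain ⟨l, rfl⟩ : ∃ l, k = l + 1 := ⟨k - 1, by omega⟩
    rw [show 2 * m + 1 - (l + 1) = 2 * m - l by omega, show l + 1 - 1 = l by omega]
    have e (i : ℕ) (hi : i ≤ 2 * m) : c i = s * t ^ i * a i := if_pos hi
    rw [e _ hk, e l (by omega), e _ (by omega), e _ (by omega), hskew l (by omega),
      show 2 * m - l - 1 = 2 * m - (l + 1) by omega, hskew (l + 1) hk]
    have p1 : t ^ (l + 1) * t ^ l = t := by
      rw [pow_succ, mul_right_comm, ← mul_pow, htt, one_pow, one_mul]
    have p2 : t ^ (2 * m - l) * t ^ (2 * m - (l + 1)) = t := by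
      rw [show 2 * m - l = 2 * m - (l + 1) + 1 by omega, pow_succ, mul_right_comm, ← mul_pow, htt,
        one_pow, one_mul]
    have p3 : (-1 : ℤ) ^ (m + l) * (-1) ^ (m + (l + 1)) = -1 := by
      rw [← pow_add, Odd.neg_one_pow ⟨m + l, by ring⟩]
    linear_combination s * s * a l * a (l + 1) * (p1 + p2 * (-1 : ℤ) ^ (m + l) *
      (-1) ^ (m + (l + 1)) + t * p3)
  refine half_difference_contradiction m hm v ?_ ?_ ?_ ?_ ?_
  · simp [v]
  · simp [v, hc0, hc1]
  · intro i _
    have := hc i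
    have := hc (i - 1)
    rw [abs_le]
    simp only [v]
    omega
  · intro j hj hjm
    obtain ⟨l, rfl⟩ : ∃ l, j = l + 1 := ⟨j - 1, by omega⟩
    refine half_difference_recurrence c v (by simp [v]) hc0 hcv l ?_
    rw [hcconv _ hjm, hcconv l (by omega)]
  · intro k hk1 hk
    have h := hcskew k hk1 hk
    simp only [v]
    rcases hc k with h1 | h1 <;> rcases hc (k - 1) with h2 | h2 <;>
      rcases hc (2 * m + 1 - k) with h3 | h3 <;>
      rcases hc (2 * m + 1 - k - 1) with h4 | h4 <;>
      rw [h1, h2, h3, h4] at h <;> simp [h1, h2, h3, h4] at h ⊢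

/-- The coefficients of `P * P^*` are the aperiodic autocorrelations of the coefficients of `P`. -/
theorem coeff_mul_reflect {R : Type*} [CommSemiring R] (P : R[X]) (N k : ℕ)
    (hP : P.natDegree ≤ N) :
    (P * P.reflect N).coeff (N + k) =
      ∑ i ∈ range (N + 1 - k), P.coeff i * P.coeff (i + k) := by
  rw [coeff_mul, Finset.Nat.sum_antidiagonal_eq_sum_range_succ_mk,
    show (N + k).succ = k + (N + 1) by omega, Finset.sum_range_add, Finset.sum_eq_zero, zero_add]
  · symm
    refine Finset.sum_subset_zero_on_sdiff (range_mono (by omega)) (fun i hi => ?_) fun i hi => ?_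
    · simp only [mem_sdiff, mem_range] at hi
      rw [coeff_eq_zero_of_natDegree_lt (by omega : P.natDegree < k + i), zero_mul]
    · rw [mem_range] at hi
      rw [coeff_reflect, revAt_le (by omega), show N - (N + k - (k + i)) = i by omega,
        add_comm k i, mul_comm]
  · intro i hi
    rw [mem_range] at hi
    rw [coeff_reflect, revAt_eq_self_of_lt (by omega),
      coeff_eq_zero_of_natDegree_lt (by omega : P.natDegree < N + k - i), mul_zero]

theorem stmt15 (m n : ℕ) (hn : n = 2 * m + 1) (h13 : 13 < n) :
    ¬ ∃ P : Polynomial ℤ, P.natDegree = 2 * m ∧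
      (∀ i ≤ 2 * m, P.coeff i = 1 ∨ P.coeff i = -1) ∧
      C ((2 * m + 1 : ℤ)) * X ^ (2 * m) +
          C ((-1 : ℤ) ^ m) * ∑ j ∈ Icc 1 m, (X ^ (2 * m - 2 * j) + X ^ (2 * m + 2 * j)) =
        P * Polynomial.reflect (2 * m) P := by
  rintro ⟨P, hdeg, hP, hQ⟩
  have hcorr (k : ℕ) (hk : 1 ≤ k) :
      ∑ i ∈ range (2 * m + 1 - k), P.coeff i * P.coeff (i + k) =
        (-1) ^ m * ∑ j ∈ Icc 1 m, if k = 2 * j then 1 else 0 := by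
    rw [← coeff_mul_reflect P (2 * m) k hdeg.le, ← hQ, coeff_add, coeff_C_mul, coeff_C_mul,
      coeff_X_pow, if_neg (by omega), finsetSum_coeff, mul_zero, zero_add]
    congr 1
    refine Finset.sum_congr rfl fun j hj => ?_
    rw [coeff_add, coeff_X_pow, coeff_X_pow, if_neg (by omega), zero_add]
    congr 1
    simp
  refine no_barker_of_seven_le P.coeff m (by omega) hP (fun k hk => ?_) fun k hk1 hkm => ?_
  · rw [hcorr k (by omega), Finset.sum_eq_zero, mul_zero]
    intro j _
    rw [if_neg (by omega)]
  · rw [hcorr (2 * k) (by omega), Finset.sum_eq_single_of_mem k (mem_Icc.2 ⟨hk1, hkm⟩)]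
    · simp
    · intro j _ hj
      rw [if_neg (by omega)]
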